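/- Let n,m ≥ 1, 1 ≤ i ≤ n, σ ∈ S_n and τ ∈ S_m. Then: (a) GDes(T_i(σ,τ)) ∩ ([1,i−1] ∪ [i+m−1, n+m−2]) = (GDes(σ) ∩ [1,i−1]) ∪ ((GDes(σ) ∩ [i,n−1]) + (m−1)); and (b) GDes(T_i(σ,τ)) ∩ [i, i+m−2] equals GDes(τ) + (i−1) if both A_{1,b} = ∅ and A_{3,t} = ∅ (the sets from the construction of T_i), and equals ∅ otherwise. Here X + p := {x + p : x ∈ X}. -/

import Mathlib

open Equiv

/-- The one-line value (0-indexed) of a permutation of `Fin N`, extended to all of `ℕ`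
by the identity.  Position `j` (0-indexed) carries the value `pv σ j` (0-indexed). -/
def pv {N : ℕ} (σ : Equiv.Perm (Fin N)) (j : ℕ) : ℕ :=
  if h : j < N then (σ ⟨j, h⟩ : ℕ) else j

/-- The left weak (Bruhat) order on `S_N`: inclusion of inversion sets, where the
inversion set of `σ` is `{(p,q) | p < q ∧ σ p > σ q}`. -/
def wle {N : ℕ} (σ τ : Equiv.Perm (Fin N)) : Prop :=
  ∀ p q : Fin N, p < q → σ q < σ p → τ q < τ p

instance {N : ℕ} (σ τ : Equiv.Perm (Fin N)) : Decidable (wle σ τ) :=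
  inferInstanceAs (Decidable (∀ p q : Fin N, p < q → σ q < σ p → τ q < τ p))

/-- The `a`-values of the insertion construction `B_i` (0-indexed values):
`avv m s x = x` if `x < s` and `x + m - 1` otherwise. -/
def avv (m s x : ℕ) : ℕ := if x < s then x else x + m - 1

/-- The one-line values of the permutation `B_i(σ,τ) ∈ S_{n+m-1}`
(0-indexed position `i`, with `i < n`, and 0-indexed values). -/
def BFun {n m : ℕ} (i : ℕ) (σ : Equiv.Perm (Fin n)) (τ : Equiv.Perm (Fin m)) (j : ℕ) : ℕ :=
  if j < i then avv m (pv σ i) (pv σ j)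
  else if j < i + m then pv τ (j - i) + pv σ i
  else avv m (pv σ i) (pv σ (j - m + 1))

/-- `ρ ∈ S_{n+m-1}` is the permutation `B_i(σ,τ)`. -/
def IsB {n m : ℕ} (i : ℕ) (σ : Equiv.Perm (Fin n)) (τ : Equiv.Perm (Fin m))
    (ρ : Equiv.Perm (Fin (n + m - 1))) : Prop :=
  ∀ j : ℕ, j < n + m - 1 → pv ρ j = BFun i σ τ j

/-- The set of entries of the first block `L₁` of `B_i(σ,τ)` (positions `< i`, 0-indexed). -/
def bL1 {n m : ℕ} (i : ℕ) (σ : Equiv.Perm (Fin n)) (τ : Equiv.Perm (Fin m)) : Set ℕ :=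
  BFun i σ τ '' {p | p < i}

/-- The set of entries of the third block `L₃` of `B_i(σ,τ)`
(positions in `[i+m, n+m-2]`, 0-indexed). -/
def bL3 {n m : ℕ} (i : ℕ) (σ : Equiv.Perm (Fin n)) (τ : Equiv.Perm (Fin m)) : Set ℕ :=
  BFun i σ τ '' {p | i + m ≤ p ∧ p < n + m - 1}

/-- The number `k_σ`: the largest `j ≤ i` such that the interval `[σ_i - j, σ_i]`
(of actual integers, whence also `j ≤ σ_i`) is contained in `{L₁} ∪ {σ_i}`. -/
noncomputable def kpar {n m : ℕ} (i : ℕ) (σ : Equiv.Perm (Fin n)) (τ : Equiv.Perm (Fin m)) : ℕ :=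
  sSup {j | j ≤ i ∧ j ≤ pv σ i ∧
    Set.Icc (pv σ i - j) (pv σ i) ⊆ insert (pv σ i) (bL1 i σ τ)}

/-- The number `l_σ`: the largest `j ≤ n - 1 - i` such that `[η, η + j] ⊆ {η} ∪ {L₃}`,
where `η = σ_i + m - 1`. -/
noncomputable def lpar {n m : ℕ} (i : ℕ) (σ : Equiv.Perm (Fin n)) (τ : Equiv.Perm (Fin m)) : ℕ :=
  sSup {j | j ≤ n - 1 - i ∧
    Set.Icc (pv σ i + m - 1) (pv σ i + m - 1 + j) ⊆ insert (pv σ i + m - 1) (bL3 i σ τ)}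

/-- `A_{1,b}`: the entries of `L₁` smaller than `σ_i - k_σ`. -/
noncomputable def A1b {n m : ℕ} (i : ℕ) (σ : Equiv.Perm (Fin n)) (τ : Equiv.Perm (Fin m)) :
    Set ℕ := {x ∈ bL1 i σ τ | x < pv σ i - kpar i σ τ}

/-- `A_{1,t}`: the entries of `L₁` bigger than `σ_i`. -/
def A1t {n m : ℕ} (i : ℕ) (σ : Equiv.Perm (Fin n)) (τ : Equiv.Perm (Fin m)) : Set ℕ :=
  {x ∈ bL1 i σ τ | pv σ i < x}

/-- `A_{3,b}`: the entries of `L₃` smaller than `η = σ_i + m - 1`. -/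
def A3b {n m : ℕ} (i : ℕ) (σ : Equiv.Perm (Fin n)) (τ : Equiv.Perm (Fin m)) : Set ℕ :=
  {x ∈ bL3 i σ τ | x < pv σ i + m - 1}

/-- `A_{3,t}`: the entries of `L₃` bigger than `η + l_σ`. -/
noncomputable def A3t {n m : ℕ} (i : ℕ) (σ : Equiv.Perm (Fin n)) (τ : Equiv.Perm (Fin m)) :
    Set ℕ := {x ∈ bL3 i σ τ | pv σ i + m - 1 + lpar i σ τ < x}

/-- `ρ ∈ S_{n+m-1}` is the permutation `T_i(σ,τ)`:  for `m = 1` it is `σ` itself;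
for `m ≥ 2` its three blocks standardize like those of `B_i(σ,τ)` and have the
prescribed entry sets. -/
noncomputable def IsT {n m : ℕ} (i : ℕ) (σ : Equiv.Perm (Fin n)) (τ : Equiv.Perm (Fin m))
    (ρ : Equiv.Perm (Fin (n + m - 1))) : Prop :=
  if m = 1 then (∀ p : ℕ, pv ρ p = pv σ p)
  else
    (∀ p q : ℕ, p < i → q < i → (pv ρ p < pv ρ q ↔ BFun i σ τ p < BFun i σ τ q)) ∧
    (∀ p q : ℕ, i ≤ p → p < i + m → i ≤ q → q < i + m →
      (pv ρ p < pv ρ q ↔ BFun i σ τ p < BFun i σ τ q)) ∧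
    (∀ p q : ℕ, i + m ≤ p → p < n + m - 1 → i + m ≤ q → q < n + m - 1 →
      (pv ρ p < pv ρ q ↔ BFun i σ τ p < BFun i σ τ q)) ∧
    pv ρ '' {p | p < i} =
      A1b i σ τ ∪
        Set.Ico (pv σ i + m - 1 + lpar i σ τ - kpar i σ τ) (pv σ i + m - 1 + lpar i σ τ) ∪
        A1t i σ τ ∧
    pv ρ '' {p | i ≤ p ∧ p < i + m} =
      insert (pv σ i - kpar i σ τ) (insert (pv σ i + m - 1 + lpar i σ τ)
        (Set.Ioo (pv σ i - kpar i σ τ + lpar i σ τ)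
          (pv σ i + m - 1 + lpar i σ τ - kpar i σ τ))) ∧
    pv ρ '' {p | i + m ≤ p ∧ p < n + m - 1} =
      A3b i σ τ ∪ Set.Ioc (pv σ i - kpar i σ τ) (pv σ i - kpar i σ τ + lpar i σ τ) ∪
        A3t i σ τ

/-- The descent set of a permutation, 0-indexed: `p ∈ Des σ` iff `σ_p > σ_{p+1}`
(so `Des σ ⊆ {0,…,N-2}`, corresponding to the 1-indexed set `[N-1]`). -/
def DesSet {N : ℕ} (σ : Equiv.Perm (Fin N)) : Set ℕ :=
  {p | p + 1 < N ∧ pv σ (p + 1) < pv σ p}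

/-- The set of global descents of a permutation, 0-indexed: `p ∈ GDes σ` iff
`σ_a > σ_b` for all `a ≤ p < b`. -/
def GDes {N : ℕ} (σ : Equiv.Perm (Fin N)) : Set ℕ :=
  {p | p + 1 < N ∧ ∀ a b : ℕ, a ≤ p → p < b → b < N → pv σ b < pv σ a}

/-- A permutation is closed when its descent set coincides with its set of global descents. -/
def ClosedPerm {N : ℕ} (σ : Equiv.Perm (Fin N)) : Prop := DesSet σ = GDes σ

theorem pv_lt {N : ℕ} (σ : Equiv.Perm (Fin N)) {j : ℕ} (h : j < N) : pv σ j < N := by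
  simp [pv, h]

theorem pv_injective {N : ℕ} (σ : Equiv.Perm (Fin N)) : Function.Injective (pv σ) := by
  intro a b hab
  by_cases ha : a < N <;> by_cases hb : b < N
  · simpa [pv, ha, hb, Fin.val_inj] using hab
  · have := pv_lt σ ha
    rw [hab, pv, dif_neg hb] at this
    omega
  · have := pv_lt σ hb
    rw [← hab, pv, dif_neg ha] at this
    omega
  · simpa [pv, ha, hb] using hab

theorem exists_pv_eq {N : ℕ} (σ : Equiv.Perm (Fin N)) {x : ℕ} (hx : x < N) :
    ∃ j < N, pv σ j = x :=
  ⟨σ.symm ⟨x, hx⟩, (σ.symm ⟨x, hx⟩).2, by simp [pv]⟩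

/-- A function on a set is determined by its range and by the relative order of its values. -/
theorem eqOn_comp_of_image_eq {f g h : ℕ → ℕ} {P : Set ℕ}
    (hfg : ∀ p ∈ P, ∀ q ∈ P, (f p < f q ↔ g p < g q))
    (hh : StrictMonoOn h (g '' P)) (him : f '' P = h '' (g '' P)) :
    Set.EqOn f (h ∘ g) P := by
  have hlt : ∀ p ∈ P, ∀ q ∈ P, (f p < f q ↔ h (g p) < h (g q)) := fun p hp q hq => by
    rw [hfg p hp q hq, hh.lt_iff_lt ⟨p, hp, rfl⟩ ⟨q, hq, rfl⟩]
  suffices ∀ v, ∀ p ∈ P, f p = v → h (g p) = v from fun p hp => (this _ p hp rfl).symm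
  intro v
  induction v using Nat.strong_induction_on with
  | _ v ih =>
    rintro p hp rfl
    rcases lt_trichotomy (h (g p)) (f p) with hc | hc | hc
    · obtain ⟨q, hq, hqp⟩ : h (g p) ∈ f '' P := him ▸ ⟨g p, ⟨p, hp, rfl⟩, rfl⟩
      have := ih (f q) (hqp ▸ hc) q hq rfl
      have := (hlt q hq p hp).1 (hqp ▸ hc)
      omega
    · exact hc
    · obtain ⟨_, ⟨q, hq, rfl⟩, hqp⟩ : f p ∈ h '' (g '' P) := him ▸ ⟨p, hp, rfl⟩
      have hlt' := (hlt q hq p hp).2 (hqp ▸ hc)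
      have := ih (f q) hlt' q hq rfl
      omega

section Parameters

variable {n m : ℕ} (i : ℕ) (σ : Equiv.Perm (Fin n)) (τ : Equiv.Perm (Fin m))

theorem kpar_spec : kpar i σ τ ≤ pv σ i ∧
    Set.Icc (pv σ i - kpar i σ τ) (pv σ i) ⊆ insert (pv σ i) (bL1 i σ τ) :=
  (Nat.sSup_mem (s := {j | j ≤ i ∧ j ≤ pv σ i ∧
    Set.Icc (pv σ i - j) (pv σ i) ⊆ insert (pv σ i) (bL1 i σ τ)})
    ⟨0, by simp⟩ ⟨i, fun _ hj => hj.1⟩).2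

theorem lpar_spec : Set.Icc (pv σ i + m - 1) (pv σ i + m - 1 + lpar i σ τ) ⊆
    insert (pv σ i + m - 1) (bL3 i σ τ) :=
  (Nat.sSup_mem (s := {j | j ≤ n - 1 - i ∧
    Set.Icc (pv σ i + m - 1) (pv σ i + m - 1 + j) ⊆ insert (pv σ i + m - 1) (bL3 i σ τ)})
    ⟨0, by simp⟩ ⟨n - 1 - i, fun _ hj => hj.1⟩).2

theorem BFun_left {p : ℕ} (hp : p < i) : BFun i σ τ p = avv m (pv σ i) (pv σ p) := by
  simp [BFun, hp]

theorem BFun_middle {t : ℕ} (ht : t < m) : BFun i σ τ (i + t) = pv τ t + pv σ i := by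
  simp [BFun, ht]

theorem BFun_right (hm : 1 ≤ m) {q : ℕ} (hq : i < q) :
    BFun i σ τ (q + (m - 1)) = avv m (pv σ i) (pv σ q) := by
  have h₁ : ¬ q + (m - 1) < i := by omega
  have h₂ : ¬ q + (m - 1) < i + m := by omega
  have h₃ : q + (m - 1) - m + 1 = q := by omega
  simp [BFun, h₁, h₂, h₃]

theorem mem_bL1 {y : ℕ} : y ∈ bL1 i σ τ ↔ ∃ p < i, avv m (pv σ i) (pv σ p) = y := by
  constructor
  · rintro ⟨p, hp, rfl⟩
    exact ⟨p, hp, (BFun_left i σ τ hp).symm⟩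
  · rintro ⟨p, hp, rfl⟩
    exact ⟨p, hp, BFun_left i σ τ hp⟩

theorem mem_bL3 (hm : 1 ≤ m) {y : ℕ} :
    y ∈ bL3 i σ τ ↔ ∃ q, i < q ∧ q < n ∧ avv m (pv σ i) (pv σ q) = y := by
  constructor
  · rintro ⟨p, ⟨hp, hp'⟩, rfl⟩
    obtain ⟨q, rfl⟩ : ∃ q, p = q + (m - 1) := ⟨p - (m - 1), by omega⟩
    exact ⟨q, by omega, by omega, (BFun_right i σ τ hm (by omega)).symm⟩
  · rintro ⟨q, hq, hq', rfl⟩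
    exact ⟨q + (m - 1), ⟨by omega, by omega⟩, BFun_right i σ τ hm hq⟩

theorem BFun_image_middle :
    BFun i σ τ '' {p | i ≤ p ∧ p < i + m} = Set.Ico (pv σ i) (pv σ i + m) := by
  ext y
  constructor
  · rintro ⟨p, ⟨hp, hp'⟩, rfl⟩
    obtain ⟨t, rfl⟩ := Nat.exists_eq_add_of_le hp
    have := pv_lt τ (j := t) (by omega)
    rw [BFun_middle i σ τ (by omega), Set.mem_Ico]
    omega
  · rintro ⟨hy, hy'⟩
    obtain ⟨t, ht, hty⟩ := exists_pv_eq τ (x := y - pv σ i) (by omega)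
    refine ⟨i + t, ⟨by omega, by omega⟩, ?_⟩
    rw [BFun_middle i σ τ ht]
    omega

/-- The values `[σ_i - k, σ_i)` are not taken by `σ` to the right of `i`. -/
theorem add_kpar_lt (hm : 1 ≤ m) {q : ℕ} (hq : i < q) (h : pv σ q < pv σ i) :
    pv σ q + kpar i σ τ < pv σ i := by
  by_contra hc
  rcases (kpar_spec i σ τ).2 (show pv σ q ∈ Set.Icc _ _ from ⟨by omega, h.le⟩) with h' | h'
  · omega
  · obtain ⟨p, hp, hpq⟩ := (mem_bL1 i σ τ).1 h'
    have hne : pv σ p ≠ pv σ q := fun e => by have := pv_injective σ e; omega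
    unfold avv at hpq
    split_ifs at hpq <;> omega

/-- The values `(σ_i, σ_i + l]` are not taken by `σ` to the left of `i`. -/
theorem add_lpar_lt (hm : 1 ≤ m) {p : ℕ} (hp : p < i) (h : pv σ i < pv σ p) :
    pv σ i + lpar i σ τ < pv σ p := by
  by_contra hc
  rcases lpar_spec i σ τ (show pv σ p + m - 1 ∈ Set.Icc _ _ from ⟨by omega, by omega⟩)
    with h' | h'
  · omega
  · obtain ⟨q, hq, -, hpq⟩ := (mem_bL3 i σ τ hm).1 h'
    have hne : pv σ p ≠ pv σ q := fun e => by have := pv_injective σ e; omega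
    unfold avv at hpq
    split_ifs at hpq <;> omega

theorem bL1_cases (hm : 1 ≤ m) {y : ℕ} (hy : y ∈ bL1 i σ τ) :
    y < pv σ i ∨ pv σ i + m - 1 + lpar i σ τ < y := by
  obtain ⟨p, hp, rfl⟩ := (mem_bL1 i σ τ).1 hy
  have hne : pv σ p ≠ pv σ i := fun e => by have := pv_injective σ e; omega
  have := add_lpar_lt i σ τ hm hp
  unfold avv
  split_ifs <;> omega

theorem bL3_cases (hm : 1 ≤ m) {y : ℕ} (hy : y ∈ bL3 i σ τ) :
    y + kpar i σ τ < pv σ i ∨ pv σ i + m - 1 < y := by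
  obtain ⟨q, hq, -, rfl⟩ := (mem_bL3 i σ τ hm).1 hy
  have hne : pv σ q ≠ pv σ i := fun e => by have := pv_injective σ e; omega
  have := add_kpar_lt i σ τ (by omega) hq
  unfold avv
  split_ifs <;> omega

variable {i σ τ}
variable {ρ : Equiv.Perm (Fin (n + m - 1))}

theorem IsT.left (hm : 2 ≤ m) (hT : IsT i σ τ ρ) {p : ℕ} (hp : p < i) :
    (pv σ p + kpar i σ τ < pv σ i ∧ pv ρ p = pv σ p) ∨
    (pv σ i ≤ pv σ p + kpar i σ τ ∧ pv σ p < pv σ i ∧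
      pv ρ p = pv σ p + (m - 1) + lpar i σ τ) ∨
    (pv σ i + lpar i σ τ < pv σ p ∧ pv ρ p = pv σ p + (m - 1)) := by
  rw [IsT, if_neg (by omega)] at hT
  obtain ⟨hord, -, -, him, -, -⟩ := hT
  obtain ⟨hk, hK⟩ := kpar_spec i σ τ
  have hc := fun y => bL1_cases i σ τ (y := y) (by omega)
  let h : ℕ → ℕ := fun y =>
    if pv σ i ≤ y + kpar i σ τ ∧ y < pv σ i then y + (m - 1) + lpar i σ τ else y
  have key := eqOn_comp_of_image_eq (f := pv ρ) (g := BFun i σ τ) (h := h) (P := {p | p < i})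
    (fun p hp q hq => hord p q hp hq) ?_ ?_ hp
  · have hne : pv σ p ≠ pv σ i := fun e => by have := pv_injective σ e; omega
    have := add_lpar_lt i σ τ (by omega) hp
    rw [key, Function.comp, BFun_left i σ τ hp]
    simp only [h, avv]
    split_ifs <;> omega
  · intro x hx y hy hxy
    have := hc x hx
    have := hc y hy
    simp only [h]
    split_ifs <;> omega
  · rw [him]
    ext z
    constructor
    · rintro ((⟨hz, hz'⟩ | ⟨hz, hz'⟩) | ⟨hz, hz'⟩)
      · exact ⟨z, hz, if_neg (by omega)⟩
      · refine ⟨z - (m - 1) - lpar i σ τ, ?_, ?_⟩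
        · refine (hK ⟨?_, ?_⟩).resolve_left ?_ <;> omega
        · simp only [h]
          split_ifs <;> omega
      · exact ⟨z, hz, if_neg (by omega)⟩
    · rintro ⟨y, hy, rfl⟩
      have := hc y hy
      simp only [h]
      split_ifs with hif
      · refine Or.inl (Or.inr ⟨?_, ?_⟩) <;> omega
      · by_cases hlt : y < pv σ i
        · exact Or.inl (Or.inl ⟨hy, by omega⟩)
        · exact Or.inr ⟨hy, by omega⟩

theorem IsT.middle (hm : 2 ≤ m) (hT : IsT i σ τ ρ) {t : ℕ} (ht : t < m) :
    (pv τ t = 0 ∧ pv ρ (i + t) = pv σ i - kpar i σ τ) ∨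
    (0 < pv τ t ∧ pv τ t < m - 1 ∧
      pv ρ (i + t) = pv σ i - kpar i σ τ + lpar i σ τ + pv τ t) ∨
    (pv τ t = m - 1 ∧ pv ρ (i + t) = pv σ i + (m - 1) + lpar i σ τ) := by
  rw [IsT, if_neg (by omega)] at hT
  obtain ⟨-, hord, -, -, him, -⟩ := hT
  have hk := (kpar_spec i σ τ).1
  let h : ℕ → ℕ := fun y =>
    if y = pv σ i then pv σ i - kpar i σ τ
    else if y = pv σ i + (m - 1) then y + lpar i σ τ
    else y - kpar i σ τ + lpar i σ τ
  have key := eqOn_comp_of_image_eq (f := pv ρ) (g := BFun i σ τ) (h := h)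
    (P := {p | i ≤ p ∧ p < i + m}) (fun p hp q hq => hord p q hp.1 hp.2 hq.1 hq.2) ?_ ?_
    (show i + t ∈ _ from ⟨by omega, by omega⟩)
  · have := pv_lt τ ht
    rw [key, Function.comp, BFun_middle i σ τ ht]
    simp only [h]
    split_ifs <;> omega
  · rw [BFun_image_middle]
    rintro x ⟨hx, hx'⟩ y ⟨hy, hy'⟩ hxy
    simp only [h]
    split_ifs <;> omega
  · rw [him, BFun_image_middle]
    ext z
    constructor
    · rintro (rfl | rfl | ⟨hz, hz'⟩)
      · exact ⟨pv σ i, ⟨by omega, by omega⟩, if_pos rfl⟩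
      · refine ⟨pv σ i + (m - 1), ⟨by omega, by omega⟩, ?_⟩
        simp only [h]
        split_ifs <;> omega
      · refine ⟨z - lpar i σ τ + kpar i σ τ, ⟨by omega, by omega⟩, ?_⟩
        simp only [h]
        split_ifs <;> omega
    · rintro ⟨y, ⟨hy, hy'⟩, rfl⟩
      simp only [h, Set.mem_insert_iff, Set.mem_Ioo]
      split_ifs <;> omega

theorem IsT.right (hm : 2 ≤ m) (hT : IsT i σ τ ρ) {q : ℕ} (hq : i < q) (hqn : q < n) :
    (pv σ q + kpar i σ τ < pv σ i ∧ pv ρ (q + (m - 1)) = pv σ q) ∨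
    (pv σ i < pv σ q ∧ pv σ q ≤ pv σ i + lpar i σ τ ∧
      pv ρ (q + (m - 1)) = pv σ q - kpar i σ τ) ∨
    (pv σ i + lpar i σ τ < pv σ q ∧ pv ρ (q + (m - 1)) = pv σ q + (m - 1)) := by
  rw [IsT, if_neg (by omega)] at hT
  obtain ⟨-, -, hord, -, -, him⟩ := hT
  have hk := (kpar_spec i σ τ).1
  have hL := lpar_spec i σ τ
  have hc := fun y => bL3_cases i σ τ (y := y) (by omega)
  let h : ℕ → ℕ := fun y =>
    if pv σ i + (m - 1) < y ∧ y ≤ pv σ i + (m - 1) + lpar i σ τ then y - (m - 1) - kpar i σ τ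
    else y
  have key := eqOn_comp_of_image_eq (f := pv ρ) (g := BFun i σ τ) (h := h)
    (P := {p | i + m ≤ p ∧ p < n + m - 1}) (fun p hp q hq => hord p q hp.1 hp.2 hq.1 hq.2) ?_ ?_
    (show q + (m - 1) ∈ _ from ⟨by omega, by omega⟩)
  · have hne : pv σ q ≠ pv σ i := fun e => by have := pv_injective σ e; omega
    have := add_kpar_lt i σ τ (by omega) hq
    rw [key, Function.comp, BFun_right i σ τ (by omega) hq]
    simp only [h, avv]
    split_ifs <;> omega
  · intro x hx y hy hxy
    have := hc x hx
    have := hc y hy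
    simp only [h]
    split_ifs <;> omega
  · rw [him]
    ext z
    constructor
    · rintro ((⟨hz, hz'⟩ | ⟨hz, hz'⟩) | ⟨hz, hz'⟩)
      · have := hc z hz
        exact ⟨z, hz, if_neg (by omega)⟩
      · refine ⟨z + (m - 1) + kpar i σ τ, ?_, ?_⟩
        · refine (hL ⟨?_, ?_⟩).resolve_left ?_ <;> omega
        · simp only [h]
          split_ifs <;> omega
      · exact ⟨z, hz, if_neg (by omega)⟩
    · rintro ⟨y, hy, rfl⟩
      have := hc y hy
      simp only [h]
      split_ifs with hif
      · refine Or.inl (Or.inr ⟨?_, ?_⟩) <;> omega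
      · by_cases hlt : y < pv σ i
        · exact Or.inl (Or.inl ⟨hy, by omega⟩)
        · exact Or.inr ⟨hy, by omega⟩

/-- A position of `T_i(σ,τ)` lies in one of the three blocks. -/
theorem block_cases (i : ℕ) {n m b : ℕ} (hm : 1 ≤ m) (hb : b < n + m - 1) :
    b < i ∨ (∃ t < m, b = i + t) ∨ ∃ q, i < q ∧ q < n ∧ b = q + (m - 1) := by
  by_cases h₁ : b < i
  · exact Or.inl h₁
  by_cases h₂ : b < i + m
  · exact Or.inr (Or.inl ⟨b - i, by omega, by omega⟩)
  · exact Or.inr (Or.inr ⟨b - (m - 1), by omega, by omega, by omega⟩)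

theorem IsT.mem_GDes_left (hm : 2 ≤ m) (hi : i < n) (hT : IsT i σ τ ρ) {p : ℕ} (hp : p < i) :
    p ∈ GDes ρ ↔ p ∈ GDes σ := by
  have hk := (kpar_spec i σ τ).1
  constructor
  · rintro ⟨-, h⟩
    refine ⟨by omega, fun a b ha hb hbn => ?_⟩
    have hA := hT.left hm (show a < i by omega)
    obtain ⟨t, ht, htm⟩ := exists_pv_eq τ (x := m - 1) (by omega)
    have := h a (i + t) ha (by omega) (by omega)
    have := hT.middle hm ht
    rcases lt_trichotomy b i with hbi | rfl | hbi
    · have := h a b ha hb (by omega)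
      have := hT.left hm hbi
      omega
    · omega
    · have := h a (b + (m - 1)) ha (by omega) (by omega)
      have := hT.right hm hbi hbn
      omega
  · rintro ⟨-, h⟩
    refine ⟨by omega, fun a b ha hb hbn => ?_⟩
    have hA := hT.left hm (show a < i by omega)
    have := h a i ha hp hi
    rcases block_cases i (by omega) hbn with hbi | ⟨t, ht, rfl⟩ | ⟨q, hq, hqn, rfl⟩
    · have := h a b ha hb (by omega)
      have := hT.left hm hbi
      omega
    · have := hT.middle hm ht
      omega
    · have := h a q ha (by omega) hqn
      have := hT.right hm hq hqn
      omega

theorem IsT.mem_GDes_right (hm : 2 ≤ m) (hT : IsT i σ τ ρ) {p : ℕ} (hp : i ≤ p) :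
    p + (m - 1) ∈ GDes ρ ↔ p ∈ GDes σ := by
  have hk := (kpar_spec i σ τ).1
  constructor
  · rintro ⟨hpn, h⟩
    refine ⟨by omega, fun a b ha hb hbn => ?_⟩
    have hB := hT.right hm (show i < b by omega) hbn
    obtain ⟨t, ht, htm⟩ := exists_pv_eq τ (x := 0) (by omega)
    have := h (i + t) (b + (m - 1)) (by omega) (by omega) (by omega)
    have := hT.middle hm ht
    rcases lt_trichotomy a i with hai | rfl | hai
    · have := h a (b + (m - 1)) (by omega) (by omega) (by omega)
      have := hT.left hm hai
      omega
    · omega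
    · have := h (a + (m - 1)) (b + (m - 1)) (by omega) (by omega) (by omega)
      have := hT.right hm hai (by omega)
      omega
  · rintro ⟨hpn, h⟩
    refine ⟨by omega, fun a b ha hb hbn => ?_⟩
    obtain ⟨c, rfl⟩ : ∃ c, b = c + (m - 1) := ⟨b - (m - 1), by omega⟩
    have hB := hT.right hm (show i < c by omega) (by omega)
    have := h i c hp (by omega) (by omega)
    rcases block_cases i (by omega) (show a < n + m - 1 by omega)
      with hai | ⟨t, ht, rfl⟩ | ⟨q, hq, hqn, rfl⟩
    · have := h a c (by omega) (by omega) (by omega)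
      have := hT.left hm hai
      omega
    · have := hT.middle hm ht
      omega
    · have := h q c (by omega) (by omega) (by omega)
      have := hT.right hm hq hqn
      omega

theorem IsT.A1b_eq_empty_of_mem_GDes (hm : 2 ≤ m) (hi : i < n) (hT : IsT i σ τ ρ) {t : ℕ}
    (ht : t + 1 < m) (h : i + t ∈ GDes ρ) : A1b i σ τ = ∅ := by
  rw [Set.eq_empty_iff_forall_notMem]
  rintro x ⟨hx, hxk⟩
  obtain ⟨p, hp, rfl⟩ := (mem_bL1 i σ τ).1 hx
  have := h.2 p (i + (t + 1)) (by omega) (by omega) (by omega)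
  have := hT.middle hm ht
  have := hT.left hm hp
  have hk := (kpar_spec i σ τ).1
  unfold avv at hxk
  split_ifs at hxk <;> omega

theorem IsT.A3t_eq_empty_of_mem_GDes (hm : 2 ≤ m) (hT : IsT i σ τ ρ) {t : ℕ}
    (ht : t + 1 < m) (h : i + t ∈ GDes ρ) : A3t i σ τ = ∅ := by
  rw [Set.eq_empty_iff_forall_notMem]
  rintro x ⟨hx, hxl⟩
  obtain ⟨q, hq, hqn, rfl⟩ := (mem_bL3 i σ τ (by omega)).1 hx
  have := h.2 (i + t) (q + (m - 1)) le_rfl (by omega) (by omega)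
  have := hT.middle hm (show t < m by omega)
  have := hT.right hm hq hqn
  unfold avv at hxl
  split_ifs at hxl <;> omega

theorem IsT.mem_GDes_middle (hm : 2 ≤ m) (hi : i < n) (hT : IsT i σ τ ρ)
    (h₁ : A1b i σ τ = ∅) (h₃ : A3t i σ τ = ∅) {t : ℕ} (ht : t + 1 < m) :
    i + t ∈ GDes ρ ↔ t ∈ GDes τ := by
  have hk := (kpar_spec i σ τ).1
  constructor
  · rintro ⟨-, h⟩
    refine ⟨ht, fun a b ha hb hbm => ?_⟩
    have := h (i + a) (i + b) (by omega) (by omega) (by omega)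
    have := hT.middle hm (show a < m by omega)
    have := hT.middle hm hbm
    omega
  · rintro ⟨-, h⟩
    have hleft : ∀ p < i, pv σ i ≤ pv σ p + kpar i σ τ := by
      intro p hp
      by_contra hc
      refine Set.eq_empty_iff_forall_notMem.1 h₁ (pv σ p)
        ⟨(mem_bL1 i σ τ).2 ⟨p, hp, if_pos ?_⟩, ?_⟩ <;> omega
    have hright : ∀ q, i < q → q < n → pv σ q ≤ pv σ i + lpar i σ τ := by
      intro q hq hqn
      by_contra hc
      refine Set.eq_empty_iff_forall_notMem.1 h₃ (pv σ q + m - 1)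
        ⟨(mem_bL3 i σ τ (by omega)).2 ⟨q, hq, hqn, if_neg ?_⟩, ?_⟩ <;> omega
    refine ⟨by omega, fun a b ha hb hbn => ?_⟩
    rcases block_cases i (by omega) (show a < n + m - 1 by omega)
      with hai | ⟨u, hu, rfl⟩ | ⟨q, hq, hqn, rfl⟩
    · have := hT.left hm hai
      have := hleft a hai
      rcases block_cases i (by omega) hbn with hbi | ⟨v, hv, rfl⟩ | ⟨q, hq, hqn, rfl⟩
      · omega
      · have := h t v le_rfl (by omega) hv
        have := pv_lt τ (show t < m by omega)
        have := hT.middle hm hv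
        omega
      · have := hright q hq hqn
        have := hT.right hm hq hqn
        omega
    · have := hT.middle hm hu
      rcases block_cases i (by omega) hbn with hbi | ⟨v, hv, rfl⟩ | ⟨q, hq, hqn, rfl⟩
      · omega
      · have := h u v (by omega) (by omega) hv
        have := hT.middle hm hv
        omega
      · have := h u (t + 1) (by omega) (by omega) ht
        have := hright q hq hqn
        have := hT.right hm hq hqn
        omega
    · omega

end Parameters

-- **Lemma (global descents of `T_i(σ,τ)`).**
-- (a) On positions outside the inserted block, the global descents of `T_i(σ,τ)` are those
-- of `σ`, shifted by `m - 1` after the insertion point.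
-- (b) On positions inside the inserted block, they are those of `τ` (shifted) when
-- `A_{1,b}^σ = ∅ = A_{3,t}^σ`, and there are none otherwise.
-- (Everything is 0-indexed: position `i` here corresponds to the paper's `1 ≤ i ≤ n`.)
open Classical in
theorem GDes_T {n m : ℕ} (hn : 1 ≤ n) (hm : 1 ≤ m) (i : ℕ) (hi : i < n)
    (σ : Equiv.Perm (Fin n)) (τ : Equiv.Perm (Fin m))
    (ρT : Equiv.Perm (Fin (n + m - 1))) (hT : IsT i σ τ ρT) :
    (GDes ρT ∩ ({p | p < i} ∪ {p | i + m - 1 ≤ p})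
      = (GDes σ ∩ {p | p < i}) ∪ ((· + (m - 1)) '' (GDes σ ∩ {p | i ≤ p}))) ∧
    (GDes ρT ∩ {p | i ≤ p ∧ p + 1 < i + m}
      = if A1b i σ τ = ∅ ∧ A3t i σ τ = ∅ then (· + i) '' GDes τ else (∅ : Set ℕ)) := by
  rcases hm.eq_or_lt with rfl | hm
  · rw [IsT, if_pos rfl] at hT
    have hG : GDes ρT = GDes σ := by
      ext p
      simp only [GDes, hT, Nat.add_sub_cancel]
    have hτ : GDes τ = ∅ := Set.eq_empty_of_forall_notMem fun p hp => by
      have := hp.1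
      omega
    rw [hG, hτ, Set.image_empty, ite_self]
    constructor
    · ext p
      by_cases hp : p < i
      · simp [hp]
      · simp [hp, not_lt.1 hp]
    · ext p
      simp only [Set.mem_inter_iff, Set.mem_ofPred_eq, Set.mem_empty_iff_false, iff_false]
      omega
  · refine ⟨?_, ?_⟩
    · ext p
      constructor
      · rintro ⟨hp, hpi | hpi⟩
        · exact Or.inl ⟨(hT.mem_GDes_left hm hi hpi).1 hp, hpi⟩
        · have hpi' : i + m - 1 ≤ p := hpi
          obtain ⟨q, rfl⟩ : ∃ q, p = q + (m - 1) := ⟨p - (m - 1), by omega⟩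
          have hq : i ≤ q := by omega
          exact Or.inr ⟨q, ⟨(hT.mem_GDes_right hm hq).1 hp, hq⟩, rfl⟩
      · rintro (⟨hp, hpi⟩ | ⟨q, ⟨hq, hqi⟩, rfl⟩)
        · exact ⟨(hT.mem_GDes_left hm hi hpi).2 hp, Or.inl hpi⟩
        · have hqi' : i ≤ q := hqi
          refine ⟨(hT.mem_GDes_right hm hqi).2 hq, Or.inr ?_⟩
          change i + m - 1 ≤ q + (m - 1)
          omega
    · split_ifs with hA
      · ext p
        constructor
        · rintro ⟨hp, hip, hpm⟩
          obtain ⟨t, rfl⟩ := Nat.exists_eq_add_of_le hip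
          exact ⟨t, (hT.mem_GDes_middle hm hi hA.1 hA.2 (by omega)).1 hp, add_comm t i⟩
        · rintro ⟨t, ht, rfl⟩
          have htm := ht.1
          have h := (hT.mem_GDes_middle hm hi hA.1 hA.2 htm).2 ht
          have h' : t + i ∈ GDes ρT := by rwa [← add_comm i t]
          refine ⟨h', ?_, ?_⟩ <;> dsimp only <;> omega
      · refine Set.eq_empty_of_forall_notMem ?_
        rintro p ⟨hp, hip, hpm⟩
        obtain ⟨t, rfl⟩ := Nat.exists_eq_add_of_le hip
        have ht : t + 1 < m := by omega
        exact hA ⟨hT.A1b_eq_empty_of_mem_GDes hm hi ht hp, hT.A3t_eq_empty_of_mem_GDes hm ht hp⟩
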